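/- Let G be a vertex-weighted graph containing a 5-cycle v₁v₂v₃v₄v₅ (edges v₁v₂, v₂v₃, v₃v₄, v₄v₅, v₅v₁ on five distinct vertices) such that d(v₂)=d(v₃)=d(v₅)=2, d(v₁) ≥ 3, d(v₄) ≥ 3, w(v₁) ≥ w(v₂) ≥ w(v₃), w(v₃) ≤ w(v₄), and w(v₃) ≤ w(v₅). Let G' be the graph obtained from G by removing v₂ and v₃ and replacing the weight of v₁ by w(v₁)−w(v₂), the weight of v₄ by w(v₄)−w(v₃), and the weight of v₅ by w(v₅)−w(v₃). Then α(G) = α(G') + w(v₂) + w(v₃). -/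

import Mathlib

open scoped Classical

namespace MWIS

variable {V : Type*}

/-- A finset of vertices is an independent set of `G`. -/
def IsIndepSet (G : SimpleGraph V) (s : Finset V) : Prop :=
  ∀ ⦃a⦄, a ∈ s → ∀ ⦃b⦄, b ∈ s → ¬G.Adj a b

/-- The maximum total weight of an independent set of `G` contained in `A`
(i.e. α of the induced subgraph `G[A]`, with the inherited weights). -/
noncomputable def alphaOn [Fintype V] (G : SimpleGraph V) (w : V → ℝ) (A : Finset V) : ℝ :=
  sSup {x : ℝ | ∃ s : Finset V, s ⊆ A ∧ IsIndepSet G s ∧ x = ∑ v ∈ s, w v}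

/-- The maximum total weight of an independent set of `G`. -/
noncomputable def alpha [Fintype V] (G : SimpleGraph V) (w : V → ℝ) : ℝ :=
  alphaOn G w Finset.univ

/-- The open neighborhood of a vertex, as a finset. -/
noncomputable def nbrs [Fintype V] (G : SimpleGraph V) (v : V) : Finset V :=
  Finset.univ.filter fun u => G.Adj v u

/-- The degree of a vertex. -/
noncomputable def deg [Fintype V] (G : SimpleGraph V) (v : V) : ℕ :=
  (nbrs G v).card

/-- The closed neighborhood `N[v]` of a vertex. -/
noncomputable def closedNbrs [Fintype V] [DecidableEq V] (G : SimpleGraph V) (v : V) : Finset V :=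
  insert v (nbrs G v)

/-- The open neighborhood `N(A)` of a vertex set. -/
noncomputable def openNbhd [Fintype V] [DecidableEq V] (G : SimpleGraph V) (A : Finset V) :
    Finset V :=
  (A.biUnion fun v => nbrs G v) \ A

/-- The closed neighborhood `N[A]` of a vertex set. -/
noncomputable def closedNbhd [Fintype V] [DecidableEq V] (G : SimpleGraph V) (A : Finset V) :
    Finset V :=
  A ∪ A.biUnion fun v => nbrs G v

/-- `s` is a maximum weighted independent set of `G` with weights `w`. -/
def IsMWIS [Fintype V] (G : SimpleGraph V) (w : V → ℝ) (s : Finset V) : Prop :=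
  IsIndepSet G s ∧ ∀ t : Finset V, IsIndepSet G t → ∑ v ∈ t, w v ≤ ∑ v ∈ s, w v

/-- `A` is the vertex set of a connected component of the subgraph of `G` induced on `B`:
`A` is the set of vertices reachable from some `x ∈ B` by paths staying inside `B`. -/
def IsCompOf (G : SimpleGraph V) (B A : Finset V) : Prop :=
  ∃ x ∈ B, ∀ y, y ∈ A ↔ Relation.ReflTransGen (fun a b => a ∈ B ∧ b ∈ B ∧ G.Adj a b) x y

theorem sum_le_alphaOn [Fintype V] {G : SimpleGraph V} (w : V → ℝ) {A s : Finset V}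
    (hsA : s ⊆ A) (hs : IsIndepSet G s) : ∑ v ∈ s, w v ≤ alphaOn G w A := by
  refine le_csSup (Set.Finite.bddAbove ?_) ⟨s, hsA, hs, rfl⟩
  refine (Set.finite_range fun t : Finset V => ∑ v ∈ t, w v).subset ?_
  rintro x ⟨t, -, -, rfl⟩
  exact ⟨t, rfl⟩

theorem alphaOn_le [Fintype V] {G : SimpleGraph V} {w : V → ℝ} {A : Finset V} {c : ℝ}
    (h : ∀ s ⊆ A, IsIndepSet G s → ∑ v ∈ s, w v ≤ c) : alphaOn G w A ≤ c := by
  refine csSup_le ⟨0, ∅, by simp, by simp [IsIndepSet], by simp⟩ ?_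
  rintro x ⟨s, hsA, hs, rfl⟩
  exact h s hsA hs

theorem eq_or_eq_of_adj_of_deg_eq_two [Fintype V] {G : SimpleGraph V} {v a b u : V}
    (hd : deg G v = 2) (ha : G.Adj v a) (hb : G.Adj v b) (hab : a ≠ b) (hu : G.Adj v u) :
    u = a ∨ u = b := by
  have hsub : ({a, b} : Finset V) ⊆ nbrs G v := by
    simp [Finset.insert_subset_iff, nbrs, ha, hb]
  have heq : ({a, b} : Finset V) = nbrs G v :=
    Finset.eq_of_subset_of_card_le hsub (by rw [Finset.card_pair hab]; exact hd.le)
  have hmem : u ∈ ({a, b} : Finset V) := by simp [heq, nbrs, hu]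
  simpa using hmem

theorem IsIndepSet.subset {G : SimpleGraph V} {s t : Finset V} (hs : IsIndepSet G s)
    (hts : t ⊆ s) : IsIndepSet G t :=
  fun _ ha _ hb => hs (hts ha) (hts hb)

theorem IsIndepSet.insert [DecidableEq V] {G : SimpleGraph V} {s : Finset V} {a : V}
    (hs : IsIndepSet G s) (ha : ∀ u ∈ s, ¬G.Adj a u) : IsIndepSet G (insert a s) := by
  intro x hx y hy hxy
  rcases Finset.mem_insert.1 hx with rfl | hxs <;>
    rcases Finset.mem_insert.1 hy with rfl | hys
  · exact G.irrefl hxy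
  · exact ha _ hys hxy
  · exact ha _ hxs hxy.symm
  · exact hs hxs hys hxy

theorem sum_update_eq_add_ite [DecidableEq V] (f : V → ℝ) (a : V) (b : ℝ) (s : Finset V) :
    ∑ v ∈ s, Function.update f a b v = ∑ v ∈ s, f v + if a ∈ s then b - f a else 0 := by
  rw [← Finset.sum_ite_eq' s a fun _ => b - f a, ← Finset.sum_add_distrib]
  refine Finset.sum_congr rfl fun v _ => ?_
  by_cases hv : v = a
  · subst hv; simp
  · simp [hv]

theorem sum_eq_sum_sdiff_pair_add [DecidableEq V] (f : V → ℝ) {a b : V} (hab : a ≠ b)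
    (s : Finset V) :
    ∑ v ∈ s, f v =
      ∑ v ∈ s \ {a, b}, f v + (if a ∈ s then f a else 0) + if b ∈ s then f b else 0 := by
  rw [← Finset.sum_inter_add_sum_sdiff s {a, b} f, Finset.inter_comm, ← Finset.filter_mem_eq_inter,
    Finset.sum_filter, Finset.sum_pair hab]
  ring

/-- for a 5-cycle `v₁v₂v₃v₄v₅` with `d(v₂) = d(v₃) = d(v₅) = 2`,
`d(v₁), d(v₄) ≥ 3`, `w(v₁) ≥ w(v₂) ≥ w(v₃) ≤ w(v₄)` and `w(v₃) ≤ w(v₅)`: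
remove `v₂, v₃` and replace the weights of `v₁, v₄, v₅` by
`w(v₁) − w(v₂)`, `w(v₄) − w(v₃)`, `w(v₅) − w(v₃)`.
Then `α(G) = α(G') + w(v₂) + w(v₃)`. -/
theorem stmt10 [Fintype V] [DecidableEq V] (G : SimpleGraph V) (w : V → ℝ)
    (hw : ∀ x, 0 < w x) (v₁ v₂ v₃ v₄ v₅ : V)
    (hdist : List.Pairwise (· ≠ ·) [v₁, v₂, v₃, v₄, v₅])
    (e12 : G.Adj v₁ v₂) (e23 : G.Adj v₂ v₃) (e34 : G.Adj v₃ v₄) (e45 : G.Adj v₄ v₅)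
    (e51 : G.Adj v₅ v₁)
    (hd2 : deg G v₂ = 2) (hd3 : deg G v₃ = 2) (hd5 : deg G v₅ = 2)
    (hd1 : 3 ≤ deg G v₁) (hd4 : 3 ≤ deg G v₄)
    (hw12 : w v₂ ≤ w v₁) (hw23 : w v₃ ≤ w v₂) (hw34 : w v₃ ≤ w v₄)
    (hw35 : w v₃ ≤ w v₅) :
    alpha G w =
      alphaOn G
        (Function.update (Function.update (Function.update w v₁ (w v₁ - w v₂))
          v₄ (w v₄ - w v₃)) v₅ (w v₅ - w v₃))
        (Finset.univ \ {v₂, v₃}) + w v₂ + w v₃ := by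
  simp only [List.pairwise_cons, List.mem_cons, List.not_mem_nil, or_false, forall_eq_or_imp,
    forall_eq] at hdist
  obtain ⟨⟨n12, n13, n14, n15⟩, ⟨n23, n24, n25⟩, ⟨n34, n35⟩, n45, -⟩ := hdist
  set w' := Function.update (Function.update (Function.update w v₁ (w v₁ - w v₂))
    v₄ (w v₄ - w v₃)) v₅ (w v₅ - w v₃) with hw'
  have hsum (s : Finset V) : ∑ v ∈ s, w' v = ∑ v ∈ s, w v - (if v₁ ∈ s then w v₂ else 0)
      - (if v₄ ∈ s then w v₃ else 0) - (if v₅ ∈ s then w v₃ else 0) := by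
    rw [hw', sum_update_eq_add_ite, sum_update_eq_add_ite, sum_update_eq_add_ite,
      Function.update_of_ne n45.symm, Function.update_of_ne n15.symm,
      Function.update_of_ne n14.symm]
    split_ifs <;> ring
  have adj2 {u : V} := eq_or_eq_of_adj_of_deg_eq_two (u := u) hd2 e12.symm e23 n13
  have adj3 {u : V} := eq_or_eq_of_adj_of_deg_eq_two (u := u) hd3 e23.symm e34 n24
  have adj5 {u : V} := eq_or_eq_of_adj_of_deg_eq_two (u := u) hd5 e45.symm e51 n14.symm
  have p2 := hw v₂
  have p3 := hw v₃
  apply le_antisymm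
  · refine alphaOn_le fun s _ hs => ?_
    have hle := sum_le_alphaOn w' (Finset.sdiff_subset_sdiff (Finset.subset_univ s) subset_rfl)
      (hs.subset (Finset.sdiff_subset (t := {v₂, v₃})))
    rw [hsum] at hle
    rw [sum_eq_sum_sdiff_pair_add w n23]
    have i12 : v₁ ∈ s → v₂ ∉ s := fun h h' => hs h h' e12
    have i23 : v₂ ∈ s → v₃ ∉ s := fun h h' => hs h h' e23
    have i34 : v₃ ∈ s → v₄ ∉ s := fun h h' => hs h h' e34
    have i45 : v₄ ∈ s → v₅ ∉ s := fun h h' => hs h h' e45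
    have i51 : v₅ ∈ s → v₁ ∉ s := fun h h' => hs h h' e51
    simp only [Finset.mem_sdiff, Finset.mem_insert, Finset.mem_singleton, n12, n13, n24.symm,
      n34.symm, n25.symm, n35.symm, or_self, not_false_eq_true, and_true] at hle
    split_ifs at hle ⊢ <;> grind only
  · suffices h : alphaOn G w' (Finset.univ \ {v₂, v₃}) ≤ alpha G w - w v₂ - w v₃ by linarith
    refine alphaOn_le fun s hsA hs => ?_
    have h2 : v₂ ∉ s := fun h => by simpa using hsA h
    have h3 : v₃ ∉ s := fun h => by simpa using hsA h
    have hle (t : Finset V) (ht : IsIndepSet G t) : ∑ v ∈ t, w v ≤ alpha G w :=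
      sum_le_alphaOn w (Finset.subset_univ t) ht
    have i45 : v₄ ∈ s → v₅ ∉ s := fun h h' => hs h h' e45
    have i51 : v₅ ∈ s → v₁ ∉ s := fun h h' => hs h h' e51
    rw [hsum]
    by_cases h1 : v₁ ∈ s <;> by_cases h4 : v₄ ∈ s
    · have := hle s hs
      simp only [h1, h4, i45 h4, if_true, if_false]
      linarith
    · have h5 : v₅ ∉ s := fun h => i51 h h1
      have := hle _ (hs.insert (a := v₃) fun u hu huv => by
        rcases adj3 huv with rfl | rfl <;> contradiction)
      rw [Finset.sum_insert h3] at this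
      simp only [h1, h4, h5, if_true, if_false]
      linarith
    · have := hle _ (hs.insert (a := v₂) fun u hu huv => by
        rcases adj2 huv with rfl | rfl <;> contradiction)
      rw [Finset.sum_insert h2] at this
      simp only [h1, h4, i45 h4, if_true, if_false]
      linarith
    · have hs5 : IsIndepSet G (insert v₅ s) := hs.insert fun u hu huv => by
        rcases adj5 huv with rfl | rfl <;> contradiction
      have := hle _ (hs5.insert (a := v₂) fun u hu huv => by
        rcases adj2 huv with rfl | rfl <;> simp_all)
      rw [Finset.sum_insert (by simp [n25, h2])] at this
      by_cases h5 : v₅ ∈ s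
      · rw [Finset.insert_eq_of_mem h5] at this
        simp only [h1, h4, h5, if_true, if_false]
        linarith
      · rw [Finset.sum_insert h5] at this
        simp only [h1, h4, h5, if_false]
        linarith

end MWIS
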